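/- arXiv:1511.06148 — 2 statements merged into one kernel-verified Lean document; each statement's English description precedes it below -/
import Mathlib

section
/- With A, τ, n and Y as above: given morphisms Y^{-n} →^{f_{-n}} Y^{-n+1} → ⋯ → Y^{-1} →^{f_{-1}} Y^0 in Y with consecutive composites zero, if this sequence is exact in A then the cokernel of f_{-1} computed in A belongs to Y = A ∩ H_τ. -/
open CategoryTheory Limits Pretriangulated

universe w v u

/-- A t-structure `(U, V)` on a triangulated category, described by two strictly full
subcategories with the usual axioms. -/
structure TSPair (D : Type*) [Category D] [Preadditive D] [HasZeroObject D]
    [HasShift D ℤ] [∀ n : ℤ, (shiftFunctor D n).Additive] [Pretriangulated D]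
    (U V : Set D) : Prop where
  iso_U : ∀ ⦃X Y : D⦄, (X ≅ Y) → X ∈ U → Y ∈ U
  iso_V : ∀ ⦃X Y : D⦄, (X ≅ Y) → X ∈ V → Y ∈ V
  hom_zero : ∀ ⦃X Y : D⦄, X ∈ U → Y ∈ V → ∀ f : X ⟶ Y⟦(-1 : ℤ)⟧, f = 0
  shift_U : ∀ ⦃X : D⦄, X ∈ U → X⟦(1 : ℤ)⟧ ∈ U
  tri : ∀ X : D, ∃ (A B : D) (f : A ⟶ X) (g : X ⟶ B) (h : B ⟶ A⟦(1 : ℤ)⟧),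
    A ∈ U ∧ B⟦(1 : ℤ)⟧ ∈ V ∧ Triangle.mk f g h ∈ distTriang D

variable (C : Type u) [Category.{v} C] [Abelian C] [HasDerivedCategory.{w} C]

/-- Membership in `D(A)^{≤ m}`: the homology vanishes in degrees `> m`. -/
def natLE (m : ℤ) (X : DerivedCategory C) : Prop :=
  ∀ k : ℤ, m < k → IsZero ((DerivedCategory.homologyFunctor C k).obj X)

/-- An object `A₀` of `A` lies in `Y = A ∩ H_τ`: the associated complex concentrated in
degree `0` belongs to the heart `H_τ = U ∩ V`. -/
def memY (U V : Set (DerivedCategory C)) (A₀ : C) : Prop :=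
  (DerivedCategory.singleFunctor C 0).obj A₀ ∈ U ∧
    (DerivedCategory.singleFunctor C 0).obj A₀ ∈ V

namespace TSPair

section Pretriangulated

variable {D : Type*} [Category D] [Preadditive D] [HasZeroObject D] [HasShift D ℤ]
  [∀ n : ℤ, (shiftFunctor D n).Additive] [Pretriangulated D] {U V : Set D}

lemma hom_eq_zero (τ : TSPair D U V) {X B : D} (hX : X ∈ U) (hB : B⟦(1 : ℤ)⟧ ∈ V)
    (g : X ⟶ B) : g = 0 := by
  let e : B ≅ (B⟦(1 : ℤ)⟧)⟦(-1 : ℤ)⟧ := (shiftShiftNeg B (1 : ℤ)).symm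
  rw [← cancel_mono e.hom, zero_comp]
  exact τ.hom_zero hX hB _

lemma mem_U_of_hom_eq_zero (τ : TSPair D U V) {X : D}
    (h : ∀ B : D, B⟦(1 : ℤ)⟧ ∈ V → ∀ g : X ⟶ B, g = 0) : X ∈ U := by
  obtain ⟨A, B, a, b, c, hA, hB, hT⟩ := τ.tri X
  have hb : b = 0 := h B hB b
  have : Mono c := Triangle.mono₃ _ hT hb
  have : IsSplitMono c := isSplitMono_of_mono c
  have hB0 : IsZero B := by
    rw [IsZero.iff_id_eq_zero, ← IsSplitMono.id c,
      τ.hom_eq_zero (τ.shift_U hA) hB (retraction c), comp_zero]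
  have : IsIso a := (Triangle.isZero₃_iff_isIso₁ _ hT).1 hB0
  exact τ.iso_U (asIso a) hA

lemma shift_mem_V_of_hom_eq_zero (τ : TSPair D U V) {X : D}
    (h : ∀ A ∈ U, ∀ g : A ⟶ X, g = 0) : X⟦(1 : ℤ)⟧ ∈ V := by
  obtain ⟨A, B, a, b, c, hA, hB, hT⟩ := τ.tri X
  have ha : a = 0 := h A hA a
  have : Epi c := Triangle.epi₃ _ hT ha
  have : IsSplitEpi c := isSplitEpi_of_epi c
  have hc : c = 0 := by
    rw [← Category.comp_id c, ← IsSplitEpi.id c,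
      τ.hom_eq_zero (τ.shift_U hA) hB (section_ c), zero_comp, comp_zero]
  have : IsIso b := (Triangle.isZero₁_iff_isIso₂ _ hT).1
    ((Triangle.isZero₁_iff _ hT).2 ⟨ha, hc⟩)
  exact τ.iso_V ((shiftFunctor D (1 : ℤ)).mapIso (asIso b).symm) hB

lemma mem_U_of_distTriang (τ : TSPair D U V) (T : Triangle D) (hT : T ∈ distTriang D)
    (h₁ : T.obj₁ ∈ U) (h₃ : T.obj₃ ∈ U) : T.obj₂ ∈ U :=
  τ.mem_U_of_hom_eq_zero fun B hB g ↦ by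
    obtain ⟨k, hk⟩ := Triangle.yoneda_exact₂ _ hT g (τ.hom_eq_zero h₁ hB _)
    rw [hk, τ.hom_eq_zero h₃ hB k, comp_zero]

lemma shift_natCast_mem_U (τ : TSPair D U V) {X : D} (hX : X ∈ U) (i : ℕ) :
    X⟦(i : ℤ)⟧ ∈ U := by
  induction i with
  | zero => exact τ.iso_U ((shiftFunctorZero' D ((0 : ℕ) : ℤ) (by simp)).app X).symm hX
  | succ i ih =>
    exact τ.iso_U ((shiftFunctorAdd' D (i : ℤ) 1 ((i + 1 : ℕ) : ℤ) (by simp)).app X).symm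
      (τ.shift_U ih)

end Pretriangulated

variable {C} {U V : Set (DerivedCategory C)}

open DerivedCategory

lemma singleFunctor_obj_mem_V (τ : TSPair (DerivedCategory C) U V)
    (hU : ∀ X ∈ U, natLE C 0 X) (A : C) : (singleFunctor C 0).obj A ∈ V := by
  let S := (singleFunctor C 0).obj A
  have : (S⟦(-1 : ℤ)⟧).IsGE 1 := TStructure.t.isGE_shift S 0 (-1) 1
  refine τ.iso_V (shiftNegShift S (1 : ℤ)) (τ.shift_mem_V_of_hom_eq_zero fun X hX g ↦ ?_)
  have : X.IsLE 0 := (isLE_iff X 0).2 (hU X hX)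
  exact TStructure.t.zero g 0 1

lemma shift_X₃_mem_U_of_shortExact (τ : TSPair (DerivedCategory C) U V) {S : ShortComplex C}
    (hS : S.ShortExact) (i : ℕ)
    (h₁ : ((singleFunctor C 0).obj S.X₁)⟦((i + 1 : ℕ) : ℤ)⟧ ∈ U)
    (h₂ : (singleFunctor C 0).obj S.X₂ ∈ U) :
    ((singleFunctor C 0).obj S.X₃)⟦(i : ℤ)⟧ ∈ U :=
  τ.mem_U_of_distTriang _ (Triangle.shift_distinguished _
    (rot_of_distTriang _ hS.singleTriangle_distinguished) (i : ℤ))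
    (τ.shift_natCast_mem_U h₂ i)
    (τ.iso_U ((shiftFunctorAdd' (DerivedCategory C) 1 (i : ℤ) ((i + 1 : ℕ) : ℤ)
      (by push_cast; ring)).app _) h₁)

lemma shift_kernel_mem_U_of_exact (τ : TSPair (DerivedCategory C) U V) {S : ShortComplex C}
    (hS : S.Exact) (i : ℕ)
    (hK : ((singleFunctor C 0).obj (kernel S.f))⟦((i + 1 : ℕ) : ℤ)⟧ ∈ U)
    (h₁ : (singleFunctor C 0).obj S.X₁ ∈ U) :
    ((singleFunctor C 0).obj (kernel S.g))⟦(i : ℤ)⟧ ∈ U := by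
  have : Epi (kernel.lift S.g S.f S.zero) := S.exact_iff_epi_kernel_lift.1 hS
  have w : kernel.ι S.f ≫ kernel.lift S.g S.f S.zero = 0 := by
    simp [← cancel_mono (kernel.ι S.g)]
  have hex : (ShortComplex.mk _ _ w).Exact := by
    refine ShortComplex.exact_of_f_is_kernel _ (KernelFork.IsLimit.ofι' _ _ fun k hk ↦ ?_)
    have hk' : k ≫ S.f = 0 := by
      simpa using hk =≫ kernel.ι S.g
    exact ⟨kernel.lift S.f k hk', kernel.lift_ι S.f k hk'⟩
  exact τ.shift_X₃_mem_U_of_shortExact (.mk hex) i hK h₁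

end TSPair

/-- Let `τ = (U, V)` be a t-structure on `D(A)` with `D(A)^{≤ -n} ⊆ U ⊆ D(A)^{≤ 0}` and let
`Y = A ∩ H_τ`. Given a sequence `Y^{-n} → Y^{-n+1} → ⋯ → Y^{-1} → Y^0` in `Y` (indexed here
as `Y 0 → Y 1 → ⋯ → Y n`, `n = m + 1`) with consecutive composites zero, if the sequence is
exact in `A`, then the cokernel of the last map computed in `A` belongs to `Y`. -/
theorem stmt_7 (U V : Set (DerivedCategory C)) (τ : TSPair (DerivedCategory C) U V)
    (n : ℕ) (hUn : ∀ X : DerivedCategory C, natLE C (-(n : ℤ)) X → X ∈ U)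
    (hU0 : ∀ X ∈ U, natLE C 0 X)
    (Y : ℕ → C) (hY : ∀ k, k ≤ n → memY C U V (Y k))
    (f : ∀ k : ℕ, Y k ⟶ Y (k + 1))
    (hw : ∀ k, k + 2 ≤ n → f k ≫ f (k + 1) = 0)
    (hexact : ∀ (k : ℕ) (hk : k + 2 ≤ n), (ShortComplex.mk (f k) (f (k + 1)) (hw k hk)).Exact)
    (m : ℕ) (hm : n = m + 1)
    (Q : C) (π : Y (m + 1) ⟶ Q) (wq : f m ≫ π = 0)
    (hcoker : Nonempty (IsColimit (CokernelCofork.ofπ π wq))) :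
    memY C U V Q := by
  subst hm
  have hK : ∀ k i : ℕ, k + i = m →
      ((DerivedCategory.singleFunctor C 0).obj (kernel (f k)))⟦((i + 1 : ℕ) : ℤ)⟧ ∈ U := by
    intro k
    induction k with
    | zero =>
      rintro i rfl
      refine hUn _ ((DerivedCategory.isLE_iff _ _).1
        (DerivedCategory.TStructure.t.isLE_shift _ 0 _ _ ?_))
      push_cast
      ring
    | succ k ih =>
      intro i hi
      exact τ.shift_kernel_mem_U_of_exact (hexact k (by lia)) (i + 1) (ih (i + 1) (by lia))
        (hY k (by lia)).1
  have hπ := ShortComplex.exact_of_g_is_cokernel (ShortComplex.mk _ _ wq) hcoker.some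
  have : Epi π := Cofork.IsColimit.epi hcoker.some
  have hker := τ.shift_kernel_mem_U_of_exact hπ 0 (hK m 0 rfl) (hY m (by lia)).1
  have hses : (ShortComplex.mk _ _ (kernel.condition π)).ShortExact :=
    .mk (ShortComplex.exact_of_f_is_kernel _ (kernelIsKernel π))
  have hQ := τ.shift_X₃_mem_U_of_shortExact hses 0
    (τ.iso_U ((shiftFunctorAdd' (DerivedCategory C) ((0 : ℕ) : ℤ) 1 ((0 + 1 : ℕ) : ℤ)
      (by simp)).app _).symm (τ.shift_U hker)) (hY (m + 1) le_rfl).1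
  exact ⟨τ.iso_U ((shiftFunctorZero' (DerivedCategory C) ((0 : ℕ) : ℤ) (by simp)).app _) hQ,
    τ.singleFunctor_obj_mem_V hU0 Q⟩
end

section
/- Let A be an abelian category and I a cogenerating additive full subcategory of A (every object of A embeds in an object of I). Then for every cochain complex X concentrated in degrees ≥ a (for some integer a) there exist a complex Y of objects of I concentrated in degrees ≥ a and a quasi-isomorphism X → Y. -/
open CategoryTheory Limits

universe v u

namespace CategoryTheory.IsPushout

/-- In an abelian category, two generalized elements of the legs of a pushout square which agree
in the pushout come, up to refinements, from a common element of the source. -/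
lemma exists_common_lift_up_to_refinements {C : Type u} [Category.{v} C] [Abelian C]
    {X₁ X₂ X₃ X₄ : C} {t : X₁ ⟶ X₂} {l : X₁ ⟶ X₃} {r : X₂ ⟶ X₄} {b : X₃ ⟶ X₄}
    (h : IsPushout t l r b) {T : C} (x₂ : T ⟶ X₂) (x₃ : T ⟶ X₃) (hx : x₂ ≫ r = x₃ ≫ b) :
    ∃ (T' : C) (π : T' ⟶ T) (_ : Epi π) (x₁ : T' ⟶ X₁), π ≫ x₂ = x₁ ≫ t ∧ π ≫ x₃ = x₁ ≫ l := by
  have hx' : biprod.lift x₂ (-x₃) ≫ biprod.desc r b = 0 := by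
    rw [biprod.lift_desc, hx, Preadditive.neg_comp, add_neg_cancel]
  obtain ⟨T', π, hπ, (x₁ : T' ⟶ X₁), hx₁⟩ := h.exact_shortComplex.exact_up_to_refinements _ hx'
  replace hx₁ : π ≫ biprod.lift x₂ (-x₃) = x₁ ≫ biprod.lift t (-l) := hx₁
  exact ⟨T', π, hπ, x₁, by simpa using hx₁ =≫ biprod.fst, by simpa using hx₁ =≫ biprod.snd⟩

end CategoryTheory.IsPushout

namespace CochainComplex

variable {A : Type u} [Category.{v} A] [Abelian A]

/-- A presentation of a morphism of complexes `φ : X ⟶ Y` as an iterated pushout: `Q (n + 1)` is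
the cokernel of the differential to `Y.X n`, the object `P (n + 1)` is the pushout of `Q (n + 1)`
and `X.X (n + 1)` over `X.X n`, and `P n` is a subobject of `Y.X n`. -/
structure CoresolutionData {X Y : CochainComplex A ℕ} (φ : X ⟶ Y) where
  /-- The cokernels of the differentials of `Y`. -/
  Q : ℕ → A
  /-- The pushouts. -/
  P : ℕ → A
  /-- The first coprojection. -/
  u (n : ℕ) : Q n ⟶ P n
  /-- The second coprojection. -/
  v (n : ℕ) : X.X n ⟶ P n
  /-- The inclusion in the target complex. -/
  j (n : ℕ) : P n ⟶ Y.X n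
  /-- The projection to the cokernel. -/
  p (n : ℕ) : Y.X n ⟶ Q (n + 1)
  mono_j (n : ℕ) : Mono (j n)
  epi_p (n : ℕ) : Epi (p n)
  u_zero : u 0 = 0
  mono_v_zero : Mono (v 0)
  f_eq (n : ℕ) : φ.f n = v n ≫ j n
  d_eq (n : ℕ) : Y.d n (n + 1) = p n ≫ u (n + 1) ≫ j (n + 1)
  u_j_p (n : ℕ) : (u n ≫ j n) ≫ p n = 0
  exact_p (n : ℕ) : (ShortComplex.mk _ _ (u_j_p n)).Exact
  isPushout (n : ℕ) : IsPushout (v n ≫ j n ≫ p n) (X.d n (n + 1)) (u (n + 1)) (v (n + 1))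

namespace CoresolutionData

attribute [instance] mono_j epi_p mono_v_zero

variable {X Y : CochainComplex A ℕ} {φ : X ⟶ Y}

lemma mono_homologyMap (D : CoresolutionData φ) (n : ℕ) : Mono (HomologicalComplex.homologyMap φ n) := by
  cases n with
  | zero =>
    rw [HomologicalComplex.mono_homologyMap_iff_up_to_refinements _ 0 0 1 (by simp) (by simp)]
    intro T x _ y hxy
    refine ⟨T, 𝟙 T, inferInstance, 0, ?_⟩
    rw [Y.shape 0 0 (by simp), comp_zero, D.f_eq, ← Category.assoc] at hxy
    simp [zero_of_comp_mono _ (zero_of_comp_mono _ hxy)]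
  | succ n =>
    rw [HomologicalComplex.mono_homologyMap_iff_up_to_refinements _ n (n + 1) (n + 2)
      (by simp) (by simp)]
    intro T x _ y hxy
    obtain ⟨T', π, hπ, w, -, hw⟩ := (D.isPushout n).exists_common_lift_up_to_refinements
      (y ≫ D.p n) x (by simpa [D.f_eq, D.d_eq, ← cancel_mono (D.j (n + 1))] using hxy.symm)
    exact ⟨T', π, hπ, w, hw⟩

/-- A cocycle of `Y` is, up to refinements, the sum of the image of a cocycle of `X` and of an
element coming from `D.Q n`. -/
lemma eq_add_up_to_refinements (D : CoresolutionData φ) (n : ℕ) {T : A} (y : T ⟶ Y.X n)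
    (hy : y ≫ Y.d n (n + 1) = 0) :
    ∃ (T' : A) (π : T' ⟶ T) (_ : Epi π) (x : T' ⟶ X.X n) (_ : x ≫ X.d n (n + 1) = 0)
      (t : T' ⟶ D.Q n), π ≫ y = x ≫ φ.f n + t ≫ D.u n ≫ D.j n := by
  obtain ⟨T₁, π₁, _, x, hx, hxd⟩ := (D.isPushout n).exists_common_lift_up_to_refinements
    (y ≫ D.p n) 0 (by simpa [D.d_eq, ← cancel_mono (D.j (n + 1))] using hy)
  obtain ⟨T₂, π₂, _, t, ht⟩ := (D.exact_p n).exact_up_to_refinements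
    (π₁ ≫ y - x ≫ D.v n ≫ D.j n) (by simp [hx])
  replace ht : π₂ ≫ (π₁ ≫ y - x ≫ D.v n ≫ D.j n) = t ≫ D.u n ≫ D.j n := ht
  refine ⟨T₂, π₂ ≫ π₁, inferInstance, π₂ ≫ x, by simp [← hxd], t, ?_⟩
  simp [← ht, D.f_eq]

lemma epi_homologyMap (D : CoresolutionData φ) (n : ℕ) : Epi (HomologicalComplex.homologyMap φ n) := by
  rw [HomologicalComplex.epi_homologyMap_iff_up_to_refinements _ _ n (n + 1) rfl (by simp)]
  intro T y hy
  obtain ⟨T₁, π₁, _, x, hx, t, ht⟩ := D.eq_add_up_to_refinements n y hy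
  cases n with
  | zero => exact ⟨T₁, π₁, inferInstance, x, hx, 0, by simpa [D.u_zero] using ht⟩
  | succ n =>
    obtain ⟨T₂, π₂, _, z, hz⟩ := surjective_up_to_refinements_of_epi (D.p n) t
    rw [CochainComplex.prev_nat_succ]
    refine ⟨T₂, π₂ ≫ π₁, inferInstance, π₂ ≫ x, by simp [hx], z, ?_⟩
    simp [ht, D.d_eq, reassoc_of% hz]

lemma quasiIso (D : CoresolutionData φ) : QuasiIso φ := by
  rw [quasiIso_iff]
  intro n
  rw [quasiIsoAt_iff_isIso_homologyMap]
  have := D.mono_homologyMap n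
  have := D.epi_homologyMap n
  exact isIso_of_mono_of_epi _

end CoresolutionData

/-- The data from which the term in a given degree of a coresolution is built: `Q` is the cokernel
of the previous differential, and `P` is the object to be embedded in the next term. -/
structure CoresolutionStage (Z : A) where
  /-- The cokernel of the previous differential. -/
  Q : A
  /-- The object to be embedded in the next term. -/
  P : A
  /-- The map inducing the differential. -/
  u : Q ⟶ P
  /-- The map inducing the morphism from the given complex. -/
  v : Z ⟶ P

variable (E : A → A) (ι : ∀ Z : A, Z ⟶ E Z) (X : CochainComplex A ℕ)

/-- The inductive construction of the stages of the coresolution of `X` attached to a choice of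
maps `ι Z : Z ⟶ E Z`. -/
noncomputable def coresolutionStage : ∀ n : ℕ, CoresolutionStage (X.X n)
  | 0 => ⟨X.X 0, X.X 0, 0, 𝟙 _⟩
  | n + 1 =>
    let s := coresolutionStage n
    let q : X.X n ⟶ cokernel (s.u ≫ ι s.P) := s.v ≫ ι s.P ≫ cokernel.π _
    ⟨cokernel (s.u ≫ ι s.P), pushout q (X.d n (n + 1)), pushout.inl _ _, pushout.inr _ _⟩

/-- The projection from the `n`th term of the coresolution to the cokernel of the differential. -/
noncomputable def coresolutionπ (n : ℕ) :
    E (coresolutionStage E ι X n).P ⟶ (coresolutionStage E ι X (n + 1)).Q :=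
  cokernel.π ((coresolutionStage E ι X n).u ≫ ι (coresolutionStage E ι X n).P)

lemma coresolutionStage_u_comp_π (n : ℕ) :
    ((coresolutionStage E ι X n).u ≫ ι _) ≫ coresolutionπ E ι X n = 0 :=
  cokernel.condition _

lemma isPushout_coresolutionStage (n : ℕ) :
    IsPushout ((coresolutionStage E ι X n).v ≫ ι _ ≫ coresolutionπ E ι X n) (X.d n (n + 1))
      (coresolutionStage E ι X (n + 1)).u (coresolutionStage E ι X (n + 1)).v :=
  IsPushout.of_hasPushout _ _

/-- The coresolution of `X` attached to a choice of maps `ι Z : Z ⟶ E Z`. -/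
noncomputable def coresolution : CochainComplex A ℕ :=
  CochainComplex.of (fun n ↦ E (coresolutionStage E ι X n).P)
    (fun n ↦ coresolutionπ E ι X n ≫ (coresolutionStage E ι X (n + 1)).u ≫ ι _)
    (fun n ↦ by
      have := coresolutionStage_u_comp_π E ι X (n + 1)
      simp only [Category.assoc] at this ⊢
      rw [reassoc_of% this, zero_comp, comp_zero])

lemma coresolution_d (n : ℕ) :
    (coresolution E ι X).d n (n + 1) =
      coresolutionπ E ι X n ≫ (coresolutionStage E ι X (n + 1)).u ≫ ι _ :=
  CochainComplex.of_d (fun n ↦ E (coresolutionStage E ι X n).P)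
    (fun n ↦ coresolutionπ E ι X n ≫ (coresolutionStage E ι X (n + 1)).u ≫ ι _) n

/-- The canonical morphism from `X` to its coresolution. -/
noncomputable def toCoresolution : X ⟶ coresolution E ι X where
  f n := (coresolutionStage E ι X n).v ≫ ι _
  comm' := by
    rintro n _ rfl
    rw [coresolution_d]
    have h := (isPushout_coresolutionStage E ι X n).w =≫ ι _
    simp only [Category.assoc] at h
    exact (Category.assoc _ _ _).trans h

/-- The presentation of the canonical morphism from `X` to its coresolution. -/
noncomputable def coresolutionData [∀ Z, Mono (ι Z)] :
    CoresolutionData (toCoresolution E ι X) where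
  Q n := (coresolutionStage E ι X n).Q
  P n := (coresolutionStage E ι X n).P
  u n := (coresolutionStage E ι X n).u
  v n := (coresolutionStage E ι X n).v
  j _ := ι _
  p n := coresolutionπ E ι X n
  mono_j _ := inferInstanceAs (Mono (ι _))
  epi_p n := inferInstanceAs (Epi (cokernel.π ((coresolutionStage E ι X n).u ≫ ι _)))
  u_zero := rfl
  mono_v_zero := inferInstanceAs (Mono (𝟙 (X.X 0)))
  f_eq _ := rfl
  d_eq n := coresolution_d E ι X n
  u_j_p n := coresolutionStage_u_comp_π E ι X n
  exact_p _ := ShortComplex.exact_cokernel _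
  isPushout n := isPushout_coresolutionStage E ι X n

lemma quasiIso_toCoresolution [∀ Z, Mono (ι Z)] : QuasiIso (toCoresolution E ι X) :=
  (coresolutionData E ι X).quasiIso

end CochainComplex

/-- (Kashiwara–Schapira, Lemma 13.2.1) Let `A` be an abelian category and `I` a cogenerating
additive full subcategory of `A`. Then every cochain complex `X` concentrated in degrees `≥ a`
admits a quasi-isomorphism `X ⟶ Y` into a complex `Y` with terms in `I` concentrated in
degrees `≥ a`. -/
theorem stmt_9 (A : Type u) [Category.{v} A] [Abelian A] (I : Set A)
    (hiso : ∀ ⦃X Y : A⦄, (X ≅ Y) → X ∈ I → Y ∈ I)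
    (hzero : ∀ X : A, IsZero X → X ∈ I)
    (hsum : ∀ ⦃X Y : A⦄, X ∈ I → Y ∈ I → (X ⊞ Y) ∈ I)
    (hcogen : ∀ X : A, ∃ Y ∈ I, ∃ f : X ⟶ Y, Mono f)
    (a : ℤ) (X : CochainComplex A ℤ) (hX : ∀ i : ℤ, i < a → IsZero (X.X i)) :
    ∃ (Y : CochainComplex A ℤ) (f : X ⟶ Y),
      (∀ i : ℤ, i < a → IsZero (Y.X i)) ∧ (∀ i : ℤ, Y.X i ∈ I) ∧ QuasiIso f := by
  choose E hE ι hι using hcogen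
  let e := ComplexShape.embeddingUpIntGE a
  have : X.IsStrictlyGE a := (X.isStrictlyGE_iff a).2 hX
  let Y := CochainComplex.coresolution E ι (X.truncGE' e)
  have hY : ∀ i : ℤ, i < a → IsZero ((Y.extend e).X i) := fun i hi ↦
    Y.isZero_extend_X e i ((ComplexShape.notMem_range_embeddingUpIntGE_iff a i).2 hi)
  let g : HomologicalComplex.truncGE X e ⟶ Y.extend e :=
    HomologicalComplex.extendMap (CochainComplex.toCoresolution E ι (X.truncGE' e)) e
  have hg : QuasiIso g := (HomologicalComplex.quasiIso_extendMap_iff _ e).2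
    (CochainComplex.quasiIso_toCoresolution E ι _)
  refine ⟨Y.extend e, HomologicalComplex.πTruncGE X e ≫ g, hY, fun i ↦ ?_, quasiIso_comp _ _⟩
  obtain hi | hi := lt_or_ge i a
  · exact hzero _ (hY i hi)
  · obtain ⟨n, hn⟩ := Int.eq_ofNat_of_zero_le (sub_nonneg.2 hi)
    exact hiso (Y.extendXIso e (i := n) (by change a + (n : ℤ) = i; lia)).symm (hE _)
end
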